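/- SUOL ⊂ FMV: let 𝒳 be a separable metric space, 𝒴 a measurable value space and ℓ an unbounded loss (satisfying ℓ(y,y)=0 and a relaxed triangle inequality with finite constant c_ℓ). If a stochastic process 𝕏 on 𝒳 admits a strongly universally consistent online learning rule, then for every countable measurable partition {A_k}_{k≥1} of 𝒳, almost surely 𝕏 visits only finitely many of the sets A_k. -/

import Mathlib

open MeasureTheory Filter Finset

noncomputable section

/-- An online learning rule: a sequence of measurable functions
`f t : 𝒳^t × 𝒴^t × 𝒳 → 𝒴` mapping the history of the first `t` labeled examples and a new
input point to a prediction. -/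
def IsOnlineLearningRule {𝒳 𝒴 : Type*} [MeasurableSpace 𝒳] [MeasurableSpace 𝒴]
    (f : (t : ℕ) → (Fin t → 𝒳) → (Fin t → 𝒴) → 𝒳 → 𝒴) : Prop :=
  ∀ t : ℕ, Measurable fun p : (Fin t → 𝒳) × (Fin t → 𝒴) × 𝒳 => f t p.1 p.2.1 p.2.2

/-- The average cumulative loss of the learning rule `f` on the process `X` with target `fstar`
after `T` rounds. -/
def avgLoss {𝒳 𝒴 Ω : Type*} (ℓ : 𝒴 → 𝒴 → ℝ)
    (f : (t : ℕ) → (Fin t → 𝒳) → (Fin t → 𝒴) → 𝒳 → 𝒴)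
    (X : ℕ → Ω → 𝒳) (fstar : 𝒳 → 𝒴) (T : ℕ) (ω : Ω) : ℝ :=
  (∑ t ∈ Finset.range T,
      ℓ (f t (fun s : Fin t => X s ω) (fun s : Fin t => fstar (X s ω)) (X t ω))
        (fstar (X t ω))) / (T : ℝ)

/-- Strong universal consistency of the learning rule `f` under the process `X`: for every
measurable target function, the long-run average loss has `limsup` equal to `0` almost surely. -/
def StronglyUniversallyConsistent {𝒳 𝒴 Ω : Type*} [MeasurableSpace 𝒳] [MeasurableSpace 𝒴]
    [MeasurableSpace Ω] (P : Measure Ω) (ℓ : 𝒴 → 𝒴 → ℝ)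
    (f : (t : ℕ) → (Fin t → 𝒳) → (Fin t → 𝒴) → 𝒳 → 𝒴) (X : ℕ → Ω → 𝒳) : Prop :=
  ∀ fstar : 𝒳 → 𝒴, Measurable fstar →
    ∀ᵐ ω ∂P, Filter.limsup (fun T : ℕ => ((avgLoss ℓ f X fstar T ω : ℝ) : EReal)) atTop = 0

/-- Condition FS: the process almost surely takes only finitely many distinct values. -/
def FS {𝒳 Ω : Type*} [MeasurableSpace Ω] (P : Measure Ω) (X : ℕ → Ω → 𝒳) : Prop :=
  ∀ᵐ ω ∂P, (Set.range fun t => X t ω).Finite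

/-- Condition FMV: for every countable measurable partition of the space, the process almost
surely visits only finitely many cells. -/
def FMV {𝒳 Ω : Type*} [MeasurableSpace 𝒳] [MeasurableSpace Ω]
    (P : Measure Ω) (X : ℕ → Ω → 𝒳) : Prop :=
  ∀ A : ℕ → Set 𝒳, (∀ k, MeasurableSet (A k)) → Pairwise (Function.onFun Disjoint A) →
    (⋃ k, A k) = Set.univ →
    ∀ᵐ ω ∂P, {k : ℕ | ∃ t, X t ω ∈ A k}.Finite

/-- Flip the `k`-th bit. -/
def flipBit (k : ℕ) (b : ℕ → Bool) : ℕ → Bool := fun i => (if i = k then not else id) (b i)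

theorem measurable_flipBit (k : ℕ) : Measurable (flipBit k) := by
  unfold flipBit
  refine measurable_pi_iff.2 fun i => ?_
  exact (measurable_of_countable (if i = k then not else id : Bool → Bool)).comp
    (measurable_pi_apply i)

/-- Existence of a flip-invariant probability measure on bit sequences. -/
theorem exists_coin : ∃ ν : Measure (ℕ → Bool), IsProbabilityMeasure ν ∧
    ∀ k, ν.map (flipBit k) = ν := by
  let μ : Measure Bool := (2⁻¹ : ENNReal) • (Measure.dirac true + Measure.dirac false)
  have hμ : IsProbabilityMeasure μ := ⟨by
    simp only [μ, Measure.smul_apply, Measure.add_apply, measure_univ, smul_eq_mul]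
    rw [one_add_one_eq_two]
    exact ENNReal.inv_mul_cancel (by norm_num) (by norm_num)⟩
  have hflip : μ.map not = μ := by
    have hm : Measurable not := measurable_of_countable _
    simp only [μ]
    rw [Measure.map_smul, Measure.map_add _ _ hm, Measure.map_dirac' hm, Measure.map_dirac' hm]
    simp [add_comm]
  refine ⟨Measure.infinitePi (fun _ : ℕ => μ), inferInstance, fun k => ?_⟩
  have h := Measure.infinitePi_map_pi (μ := fun _ : ℕ => μ)
    (f := fun i : ℕ => (if i = k then not else id : Bool → Bool))
    (fun i => measurable_of_countable _)
  unfold flipBit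
  rw [h]
  congr 1
  funext i
  by_cases hi : i = k
  · simp [hi, hflip]
  · simp [hi]

/-- For each event-sequence, occurring at all but not before time `T` has small probability. -/
theorem exists_time {Ω : Type*} [MeasurableSpace Ω] (P : Measure Ω) [IsProbabilityMeasure P]
    (E : ℕ → Set Ω) (hE : ∀ t, MeasurableSet (E t)) (ε : ENNReal) (hε : 0 < ε) :
    ∃ T : ℕ, P {ω | (∃ t, ω ∈ E t) ∧ ∀ t < T, ω ∉ E t} < ε := by
  let B : ℕ → Set Ω := fun T => {ω | (∃ t, ω ∈ E t) ∧ ∀ t < T, ω ∉ E t}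
  have hB : ∀ T, MeasurableSet (B T) := by
    intro T
    have : B T = (⋃ t, E t) ∩ ⋂ t, ⋂ (_ : t < T), (E t)ᶜ := by
      ext ω; simp [B]
    rw [this]
    exact (MeasurableSet.iUnion hE).inter
      (MeasurableSet.iInter fun t => MeasurableSet.iInter fun _ => (hE t).compl)
  have hanti : Antitone B := fun S T hST ω hω => ⟨hω.1, fun t ht => hω.2 t (ht.trans_le hST)⟩
  have hlim := tendsto_measure_iInter_atTop (μ := P) (fun T => (hB T).nullMeasurableSet) hanti
    ⟨0, measure_ne_top _ _⟩
  have hempty : (⋂ T, B T) = ∅ := by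
    ext ω
    simp only [Set.mem_iInter, Set.mem_empty_iff_false, iff_false]
    intro h
    obtain ⟨t, ht⟩ := (h 0).1
    exact (h (t + 1)).2 t (Nat.lt_succ_self t) ht
  rw [hempty, measure_empty] at hlim
  exact ((tendsto_order.1 hlim).2 ε hε).exists

/-- **Theorem (SUOL ⊆ FMV).** Let `𝒳` be a separable metric space, `𝒴` a measurable value
space and `ℓ` an unbounded measurable loss satisfying `ℓ y y = 0` and a relaxed triangle
inequality with finite constant `cℓ`. If a stochastic process `X` on `𝒳` admits a strongly
universally consistent online learning rule, then for every countable measurable partition of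
`𝒳`, almost surely `X` visits only finitely many of its cells. -/
theorem suol_subset_fmv {𝒳 𝒴 Ω : Type*} [MetricSpace 𝒳] [TopologicalSpace.SeparableSpace 𝒳]
    [MeasurableSpace 𝒳] [BorelSpace 𝒳] [MeasurableSpace 𝒴]
    (ℓ : 𝒴 → 𝒴 → ℝ) (cℓ : ℝ)
    (hℓmeas : Measurable fun p : 𝒴 × 𝒴 => ℓ p.1 p.2)
    (hℓnonneg : ∀ y y' : 𝒴, 0 ≤ ℓ y y')
    (hℓrefl : ∀ y : 𝒴, ℓ y y = 0)
    (hℓtri : ∀ y₁ y₂ y₃ : 𝒴, ℓ y₁ y₃ ≤ cℓ * (ℓ y₂ y₁ + ℓ y₂ y₃))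
    (hℓunbounded : ∀ C : ℝ, ∃ y y' : 𝒴, C < ℓ y y')
    [MeasurableSpace Ω] (P : Measure Ω) [IsProbabilityMeasure P]
    (X : ℕ → Ω → 𝒳) (hX : ∀ t, Measurable (X t))
    (hSUOL : ∃ f : (t : ℕ) → (Fin t → 𝒳) → (Fin t → 𝒴) → 𝒳 → 𝒴,
        IsOnlineLearningRule f ∧ StronglyUniversallyConsistent P ℓ f X) :
    FMV P X := by
  classical
  obtain ⟨f, hf, hcons⟩ := hSUOL
  intro A hA hdisj hcov
  have hex : ∀ x, ∃ k, x ∈ A k := fun x => by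
    have : x ∈ ⋃ k, A k := hcov ▸ Set.mem_univ x
    simpa using this
  choose idx hidx using hex
  have hidx_iff : ∀ x k, x ∈ A k ↔ idx x = k := by
    intro x k
    constructor
    · intro h
      by_contra hne
      exact Set.disjoint_left.1 (hdisj hne) (hidx x) h
    · rintro rfl
      exact hidx x
  have hidxm : Measurable idx := measurable_to_countable' fun k => by
    have : idx ⁻¹' {k} = A k := by
      ext x; simp [hidx_iff]
    rw [this]; exact hA k
  -- the times
  obtain ⟨ε, hεpos, hεsum⟩ := ENNReal.exists_pos_sum_of_countable' (ε := 1) one_ne_zero ℕ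
  have htime : ∀ k, ∃ T : ℕ, P {ω | (∃ t, ω ∈ (X t) ⁻¹' (A k)) ∧
      ∀ t < T, ω ∉ (X t) ⁻¹' (A k)} < ε k := fun k =>
    exists_time P (fun t => (X t) ⁻¹' (A k)) (fun t => hX t (hA k)) (ε k) (hεpos k)
  choose τ hτ using htime
  have hBC : ∀ᵐ ω ∂P, ∀ᶠ k in atTop, ω ∉ {ω | (∃ t, ω ∈ (X t) ⁻¹' (A k)) ∧
      ∀ t < τ k, ω ∉ (X t) ⁻¹' (A k)} := by
    apply ae_eventually_notMem
    exact ((ENNReal.tsum_le_tsum fun k => (hτ k).le).trans_lt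
      (hεsum.trans ENNReal.one_lt_top)).ne
  -- the values
  have hval := fun k => hℓunbounded (|cℓ| * (2 * (τ k : ℝ)))
  choose y0 y1 hy using hval
  let v : ℕ × Bool → 𝒴 := fun p => if p.2 then y1 p.1 else y0 p.1
  have hv : Measurable v := measurable_of_countable v
  let F : (ℕ → Bool) → 𝒳 → 𝒴 := fun b x => v (idx x, b (idx x))
  have heval : Measurable fun p : (ℕ → Bool) × ℕ => p.1 p.2 :=
    measurable_from_prod_countable_left fun k => measurable_pi_apply k
  have hF : Measurable fun p : (ℕ → Bool) × 𝒳 => F p.1 p.2 := by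
    refine hv.comp ?_
    exact (hidxm.comp measurable_snd).prodMk
      (heval.comp (measurable_fst.prodMk (hidxm.comp measurable_snd)))
  obtain ⟨ν, hν, hflip⟩ := exists_coin
  have hXm : ∀ s, Measurable fun p : (ℕ → Bool) × Ω => X s p.2 := fun s =>
    (hX s).comp measurable_snd
  have hFX : ∀ s, Measurable fun p : (ℕ → Bool) × Ω => F p.1 (X s p.2) := fun s =>
    hF.comp (measurable_fst.prodMk (hXm s))
  have hloss : ∀ T, Measurable fun p : (ℕ → Bool) × Ω => avgLoss ℓ f X (F p.1) T p.2 := by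
    intro T
    unfold avgLoss
    refine Measurable.div_const (Finset.measurable_sum _ fun t _ => ?_) _
    refine hℓmeas.comp (Measurable.prodMk ?_ (hFX t))
    refine (hf t).comp (Measurable.prodMk ?_ (Measurable.prodMk ?_ (hXm t)))
    · exact measurable_pi_iff.2 fun s => hXm s
    · exact measurable_pi_iff.2 fun s => hFX s
  have hmeas : ∀ N, MeasurableSet
      {p : (ℕ → Bool) × Ω | ∀ T ≥ N, avgLoss ℓ f X (F p.1) T p.2 < 1} := by
    intro N
    simp only [Set.ofPred_forall]
    exact MeasurableSet.iInter fun T => MeasurableSet.iInter fun _ =>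
      measurableSet_lt (hloss T) measurable_const
  have hmeas' : MeasurableSet
      {p : (ℕ → Bool) × Ω | ∃ N, ∀ T ≥ N, avgLoss ℓ f X (F p.1) T p.2 < 1} := by
    rw [Set.ofPred_exists]
    exact MeasurableSet.iUnion hmeas
  have h1 : ∀ b, ∀ᵐ ω ∂P, ∃ N, ∀ T ≥ N, avgLoss ℓ f X (F b) T ω < 1 := by
    intro b
    have hFb : Measurable (F b) := hF.comp (measurable_const.prodMk measurable_id)
    filter_upwards [hcons (F b) hFb] with ω hω
    have hlt : Filter.limsup (fun T : ℕ => ((avgLoss ℓ f X (F b) T ω : ℝ) : EReal)) atTop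
        < ((1 : ℝ) : EReal) := by
      rw [hω]; exact_mod_cast zero_lt_one
    obtain ⟨N, hN⟩ := eventually_atTop.1 (eventually_lt_of_limsup_lt hlt)
    exact ⟨N, fun T hT => by exact_mod_cast hN T hT⟩
  have h2 : ∀ᵐ ω ∂P, ∀ᵐ b ∂ν, ∃ N, ∀ T ≥ N, avgLoss ℓ f X (F b) T ω < 1 :=
    (Measure.ae_ae_comm hmeas').1 (Eventually.of_forall h1)
  filter_upwards [h2, hBC] with ω hω hBω
  by_contra hinf
  change Set.Infinite _ at hinf
  -- the good sets
  let G : ℕ → Set (ℕ → Bool) := fun N => {b | ∀ T ≥ N, avgLoss ℓ f X (F b) T ω < 1}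
  have hGm : ∀ N, MeasurableSet (G N) := fun N =>
    (measurable_id.prodMk measurable_const : Measurable fun b : ℕ → Bool => (b, ω)) (hmeas N)
  have hGmono : Monotone G := fun M N hMN b hb T hT => hb T (hMN.trans hT)
  have hGU : ν (⋃ N, G N) = 1 := by
    rw [prob_compl_eq_zero_iff (MeasurableSet.iUnion hGm) |>.symm]
    rw [← mem_ae_iff]
    filter_upwards [hω] with b hb
    exact Set.mem_iUnion.2 hb
  have hlim := tendsto_measure_iUnion_atTop (μ := ν) hGmono
  rw [hGU] at hlim
  obtain ⟨N, hN⟩ := ((tendsto_order.1 hlim).1 (2⁻¹ : ENNReal)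
    (ENNReal.inv_lt_one.2 (by norm_num))).exists
  obtain ⟨K, hK⟩ := eventually_atTop.1 hBω
  -- pick a cell
  obtain ⟨k, hkV, hk⟩ := hinf.exists_notMem_finset
    (((Finset.range N).image fun t => idx (X t ω)) ∪ Finset.range K)
  simp only [Finset.mem_union, Finset.mem_image, Finset.mem_range, not_or, not_exists, not_and,
    not_lt] at hk
  obtain ⟨hk1, hk2⟩ := hk
  have hkV' : ∃ t, X t ω ∈ A k := hkV
  let s := Nat.find hkV'
  have hs : idx (X s ω) = k := (hidx_iff _ _).1 (Nat.find_spec hkV')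
  have hsmin : ∀ t < s, idx (X t ω) ≠ k := fun t ht h =>
    Nat.find_min hkV' ht ((hidx_iff _ _).2 h)
  have hNs : N ≤ s := by
    by_contra h
    exact hk1 s (not_le.1 h) hs
  have hsτ : s < τ k := by
    by_contra h
    refine hK k hk2 ⟨hkV', fun t ht hmem => hsmin t (ht.trans_le (not_lt.1 h)) ?_⟩
    exact (hidx_iff _ _).1 hmem
  -- find the two labelings
  have hpre : ν (flipBit k ⁻¹' G N) = ν (G N) := by
    rw [← Measure.map_apply (measurable_flipBit k) (hGm N), hflip]
  obtain ⟨b, hb, hb'⟩ : (G N ∩ flipBit k ⁻¹' G N).Nonempty := by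
    refine nonempty_inter_of_measure_lt_add ν (measurable_flipBit k (hGm N))
      (Set.subset_univ _) (Set.subset_univ _) ?_
    rw [hpre, measure_univ, ← ENNReal.inv_two_add_inv_two]
    exact ENNReal.add_lt_add hN hN
  have hsingle : ∀ b ∈ G N, ℓ (f s (fun i : Fin s => X i ω)
      (fun i : Fin s => F b (X i ω)) (X s ω)) (F b (X s ω)) ≤ τ k := by
    intro b hb
    have h := hb (s + 1) (hNs.trans (Nat.le_succ s))
    unfold avgLoss at h
    rw [div_lt_one (by positivity)] at h
    have h3 := Finset.single_le_sum (f := fun t => ℓ (f t (fun i : Fin t => X i ω)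
      (fun i : Fin t => F b (X i ω)) (X t ω)) (F b (X t ω))) (s := Finset.range (s + 1))
      (fun t _ => hℓnonneg _ _) (Finset.self_mem_range_succ s)
    have h4 : ((s + 1 : ℕ) : ℝ) ≤ τ k := by exact_mod_cast hsτ
    exact (h3.trans h.le).trans h4
  have e1 := hsingle b hb
  have e2 := hsingle _ hb'
  have hpast : (fun i : Fin s => F (flipBit k b) (X i ω)) = fun i : Fin s => F b (X i ω) := by
    funext i
    simp [F, flipBit, hsmin i i.2]
  rw [hpast] at e2
  generalize f s (fun i : Fin s => X i ω) (fun i : Fin s => F b (X i ω)) (X s ω) = z at e1 e2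
  have key : ℓ z (y0 k) ≤ τ k ∧ ℓ z (y1 k) ≤ τ k := by
    simp only [F, v, hs, flipBit] at e1 e2
    cases hbk : b k <;> simp [hbk] at e1 e2
    · exact ⟨e1, e2⟩
    · exact ⟨e2, e1⟩
  have hfinal : ℓ (y0 k) (y1 k) ≤ |cℓ| * (2 * (τ k : ℝ)) := by
    refine (hℓtri (y0 k) z (y1 k)).trans ?_
    have hsum := add_nonneg (hℓnonneg z (y0 k)) (hℓnonneg z (y1 k))
    refine (mul_le_mul_of_nonneg_right (le_abs_self cℓ) hsum).trans ?_
    exact mul_le_mul_of_nonneg_left (by linarith [key.1, key.2]) (abs_nonneg _)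
  exact absurd (hy k) (not_lt.2 hfinal)

end
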